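/- Assume A ∥_M B, A ∥_M A and B ∥_M B. If A or B has at least two members, then some two A-neighbours or some two B-neighbours are M-neighbours. -/

import Mathlib

/-- `x` precedes `y` in the list `M` (`x <_M y`). -/
def ltL (M : List ℕ) (x y : ℕ) : Prop :=
  ∃ i j : ℕ, i < j ∧ M[i]? = some x ∧ M[j]? = some y

/-- `M : x−y−z`: the distinct members `x`, `y`, `z` occur in `M` in that order
or in the reverse order. -/
def BtwL (M : List ℕ) (x y z : ℕ) : Prop :=
  (ltL M x y ∧ ltL M y z) ∨ (ltL M z y ∧ ltL M y x)

/-- `x` and `y` are `L`-neighbours: one is the immediate predecessor of the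
other in `L`. -/
def Neighb (L : List ℕ) (x y : ℕ) : Prop :=
  ∃ i : ℕ, (L[i]? = some x ∧ L[i + 1]? = some y) ∨ (L[i]? = some y ∧ L[i + 1]? = some x)

/-- The immediate successor of `v` in the list `F` (if it exists). -/
def succIn (F : List ℕ) (v : ℕ) : Option ℕ :=
  if v ∈ F then F[F.idxOf v + 1]? else none

/-- The immediate predecessor of `v` in the list `F` (if it exists). -/
def predIn (F : List ℕ) (v : ℕ) : Option ℕ :=
  if v ∈ F ∧ F.idxOf v ≠ 0 then F[F.idxOf v - 1]? else none

/-- `u` and `v` are of the same parity: their indices (given by `idx`) are both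
even or both odd. -/
def SameParity (idx : ℕ → ℕ) (u v : ℕ) : Prop := idx u % 2 = idx v % 2

/-- `M[v, u, vˢ]`: the member `u` (whose own list is `Fu`) is interlaced in `M`
with `v` and its immediate successor `vˢ` in the list `Fv`. -/
def Interlaced (M : List ℕ) (idx : ℕ → ℕ) (Fu Fv : List ℕ) (u v : ℕ) : Prop :=
  u ≠ v ∧ ∃ vs, succIn Fv v = some vs ∧ BtwL M v u vs ∧
    (SameParity idx u vs → ∀ up, predIn Fu u = some up → ¬ BtwL M v up vs) ∧
    (SameParity idx u v → ∀ us, succIn Fu u = some us → ¬ BtwL M v us vs)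

/-- `F ∥_M G`: no member of `F` is interlaced in `M` with two successive members
of `G`, and no member of `G` is interlaced in `M` with two successive members
of `F`. -/
def Parallel (M : List ℕ) (idx : ℕ → ℕ) (F G : List ℕ) : Prop :=
  (∀ u ∈ F, ∀ v ∈ G, ¬ Interlaced M idx F G u v) ∧
  (∀ u ∈ G, ∀ v ∈ F, ¬ Interlaced M idx G F u v)
theorem idx_of_get {M : List ℕ} (h : M.Nodup) {i x : ℕ} (hx : M[i]? = some x) :
    M.idxOf x = i := by
  obtain ⟨hi, rfl⟩ := List.getElem?_eq_some_iff.1 hx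
  exact h.idxOf_getElem i hi

theorem get_idx {M : List ℕ} {x : ℕ} (hx : x ∈ M) : M[M.idxOf x]? = some x := by
  have h := List.idxOf_lt_length_of_mem hx
  rw [List.getElem?_eq_getElem h, List.getElem_idxOf]

theorem ltL_iff {M : List ℕ} (h : M.Nodup) (x y : ℕ) :
    ltL M x y ↔ x ∈ M ∧ y ∈ M ∧ M.idxOf x < M.idxOf y := by
  constructor
  · rintro ⟨i, j, hij, hx, hy⟩
    refine ⟨List.mem_of_getElem? hx, List.mem_of_getElem? hy, ?_⟩
    rw [idx_of_get h hx, idx_of_get h hy]; exact hij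
  · rintro ⟨hx, hy, hxy⟩
    exact ⟨_, _, hxy, get_idx hx, get_idx hy⟩

def SuccR (F : List ℕ) (x y : ℕ) : Prop := ∃ i : ℕ, F[i]? = some x ∧ F[i + 1]? = some y

theorem SuccR.succIn_eq {F : List ℕ} (h : F.Nodup) {x y : ℕ} (hr : SuccR F x y) :
    succIn F x = some y := by
  obtain ⟨i, hx, hy⟩ := hr
  rw [succIn, if_pos (List.mem_of_getElem? hx), idx_of_get h hx, hy]

theorem succR_of_succIn {F : List ℕ} {x y : ℕ} (h : succIn F x = some y) : SuccR F x y := by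
  unfold succIn at h
  split_ifs at h with hx
  exact ⟨_, get_idx hx, h⟩

theorem succR_of_predIn {F : List ℕ} {x y : ℕ} (h : predIn F x = some y) : SuccR F y x := by
  unfold predIn at h
  split_ifs at h with hx
  refine ⟨_, h, ?_⟩
  rw [Nat.sub_add_cancel (Nat.pos_of_ne_zero hx.2)]
  exact get_idx hx.1

theorem neighbours_core (A B M : List ℕ) (idx : ℕ → ℕ)
    (hAnd : A.Nodup) (hBnd : B.Nodup)
    (hMnd : M.Nodup) (hM : ∀ x, x ∈ M ↔ x ∈ A ∨ x ∈ B)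
    (hAB' : Parallel M idx A B) (hAA : Parallel M idx A A) (hBB : Parallel M idx B B) (d : ℕ) :
    ∀ (F : List ℕ) (v w : ℕ), (F = A ∨ F = B) → SuccR F v w →
      M.idxOf v ≤ M.idxOf w + d → M.idxOf w ≤ M.idxOf v + d →
      ∃ x y : ℕ, x ≠ y ∧ (Neighb A x y ∨ Neighb B x y) ∧ Neighb M x y := by
  induction d with
  | zero =>
    intro F v w hF hr h1 h2
    exfalso
    have hnd : F.Nodup := by rcases hF with rfl | rfl <;> assumption
    obtain ⟨i, hv, hw⟩ := hr
    have hvM : v ∈ M := by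
      rw [hM]; rcases hF with rfl | rfl <;> simp [List.mem_of_getElem? hv]
    have hwM : w ∈ M := by
      rw [hM]; rcases hF with rfl | rfl <;> simp [List.mem_of_getElem? hw]
    have e1 := get_idx hvM
    have e2 := get_idx hwM
    have : M.idxOf v = M.idxOf w := by omega
    rw [this, e2] at e1
    have e3 : w = v := by simpa using e1
    have := idx_of_get hnd hv
    have := idx_of_get hnd hw
    subst e3
    omega
  | succ d ih =>
    intro F v w hF hr h1 h2
    have hnd : F.Nodup := by rcases hF with rfl | rfl <;> assumption
    have hr' := hr
    obtain ⟨i, hv, hw⟩ := hr'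
    have hvM : v ∈ M := by
      rw [hM]; rcases hF with rfl | rfl <;> simp [List.mem_of_getElem? hv]
    have hwM : w ∈ M := by
      rw [hM]; rcases hF with rfl | rfl <;> simp [List.mem_of_getElem? hw]
    have hne : v ≠ w := by
      rintro rfl
      have := idx_of_get hnd hv
      have := idx_of_get hnd hw
      omega
    have e1 := get_idx hvM
    have e2 := get_idx hwM
    have hne' : M.idxOf v ≠ M.idxOf w := by
      intro h
      rw [h, e2] at e1
      exact hne (by simpa using e1.symm)
    have hN : Neighb A v w ∨ Neighb B v w := by
      rcases hF with rfl | rfl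
      · exact Or.inl ⟨i, Or.inl ⟨hv, hw⟩⟩
      · exact Or.inr ⟨i, Or.inl ⟨hv, hw⟩⟩
    by_cases hb : ∃ u, BtwL M v u w
    · obtain ⟨u, hu⟩ := hb
      have hu' := hu
      simp only [BtwL, ltL_iff hMnd] at hu'
      have huM : u ∈ M := by tauto
      have huv : u ≠ v := by
        rintro rfl
        omega
      have key : ∃ G, (G = A ∨ G = B) ∧ ¬ Interlaced M idx G F u v := by
        have hvF := List.mem_of_getElem? hv
        rcases (hM u).1 huM with h | h
        · refine ⟨A, Or.inl rfl, ?_⟩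
          rcases hF with rfl | rfl
          · exact hAA.1 u h v hvF
          · exact hAB'.1 u h v hvF
        · refine ⟨B, Or.inr rfl, ?_⟩
          rcases hF with rfl | rfl
          · exact hAB'.2 u h v hvF
          · exact hBB.1 u h v hvF
      obtain ⟨G, hG, hI⟩ := key
      by_cases c1 : ∃ up, predIn G u = some up ∧ BtwL M v up w
      · obtain ⟨p, hp, hpb⟩ := c1
        simp only [BtwL, ltL_iff hMnd] at hpb
        exact ih G p u hG (succR_of_predIn hp) (by omega) (by omega)
      by_cases c2 : ∃ us, succIn G u = some us ∧ BtwL M v us w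
      · obtain ⟨p, hp, hpb⟩ := c2
        simp only [BtwL, ltL_iff hMnd] at hpb
        exact ih G u p hG (succR_of_succIn hp) (by omega) (by omega)
      exact absurd ⟨huv, w, hr.succIn_eq hnd, hu, fun _ p hp hpb => c1 ⟨p, hp, hpb⟩,
        fun _ p hp hpb => c2 ⟨p, hp, hpb⟩⟩ hI
    · refine ⟨v, w, hne, hN, ?_⟩
      have l1 := List.idxOf_lt_length_of_mem hvM
      have l2 := List.idxOf_lt_length_of_mem hwM
      rcases Nat.lt_or_gt_of_ne hne' with hlt | hlt
      · by_cases hs : M.idxOf v + 1 = M.idxOf w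
        · exact ⟨_, Or.inl ⟨e1, by rw [hs]; exact e2⟩⟩
        · have hl : M.idxOf v + 1 < M.length := by omega
          have hg := List.getElem?_eq_getElem hl
          exact absurd ⟨_, Or.inl ⟨⟨_, _, by omega, e1, hg⟩, ⟨_, _, by omega, hg, e2⟩⟩⟩ hb
      · by_cases hs : M.idxOf w + 1 = M.idxOf v
        · exact ⟨_, Or.inr ⟨e2, by rw [hs]; exact e1⟩⟩
        · have hl : M.idxOf w + 1 < M.length := by omega
          have hg := List.getElem?_eq_getElem hl
          exact absurd ⟨_, Or.inr ⟨⟨_, _, by omega, e2, hg⟩, ⟨_, _, by omega, hg, e1⟩⟩⟩ hb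

/-- **Lemma 2.1.2**: assuming `A ∥_M B`, `A ∥_M A` and `B ∥_M B`, if `A` or `B`
has at least two members, then some two `A`-neighbours or some two
`B`-neighbours are `M`-neighbours. -/
theorem neighbours_exist (A B M : List ℕ) (k l n m : ℕ) (idx : ℕ → ℕ)
    (hAlen : A.length = n) (hBlen : B.length = m) (hn : 1 ≤ n) (hm : 1 ≤ m)
    (hAnd : A.Nodup) (hBnd : B.Nodup) (hAB : A.Disjoint B)
    (hMnd : M.Nodup) (hM : ∀ x, x ∈ M ↔ x ∈ A ∨ x ∈ B)
    (hiA : ∀ (i x : ℕ), A[i]? = some x → idx x = k + 1 + i)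
    (hiB : ∀ (j x : ℕ), B[j]? = some x → idx x = l + 1 + j)
    (hAB' : Parallel M idx A B) (hAA : Parallel M idx A A) (hBB : Parallel M idx B B)
    (htwo : 2 ≤ n ∨ 2 ≤ m) :
    ∃ x y : ℕ, x ≠ y ∧ (Neighb A x y ∨ Neighb B x y) ∧ Neighb M x y := by
  have core := fun F v w hF hr => neighbours_core A B M idx hAnd hBnd hMnd hM hAB' hAA hBB
    (M.idxOf v + M.idxOf w) F v w hF hr (by omega) (by omega)
  rcases htwo with h | h
  · exact core A _ _ (Or.inl rfl) ⟨0, List.getElem?_eq_getElem (by omega),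
      List.getElem?_eq_getElem (by omega)⟩
  · exact core B _ _ (Or.inr rfl) ⟨0, List.getElem?_eq_getElem (by omega),
      List.getElem?_eq_getElem (by omega)⟩
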